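/- Let (G,w) be a bipartite energy game (every edge goes from a node of V_A to a node of V_B or from a node of V_B to a node of V_A) in which one player wins at every node, let n = |V| and W = max_{(u,v) ∈ E} |w(u,v)|, and let (G_2,w_2) be the complete bipartite game obtained by adding, for every pair u ∈ V_A, v ∈ V_B with (u,v) ∉ E, an edge (u,v) of weight −nW, and for every pair u ∈ V_B, v ∈ V_A with (u,v) ∉ E, an edge (u,v) of weight n²W. Then the same player wins at every node of (G_2,w_2): if Alice wins at every node of (G,w) then Alice wins at every node of (G_2,w_2), and if Bob wins at every node of (G,w) then Bob wins at every node of (G_2,w_2). -/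

import Mathlib

/-!
Common definitions for energy games (Brim et al. style), following the paper's
definitions: a game graph is a finite directed graph in which every node has
out-degree at least one, together with a partition of the nodes into Alice's
nodes `VA` and Bob's nodes (the complement of `VA`).  Strategies are positional.
For a fixed pair of strategies the play from a node `s` is the orbit of the
induced successor function, and the minimal sufficient energy at `s` is the
least initial energy that keeps the running energy nonnegative forever, i.e.
`⨆ i, (-(weight of the length-i prefix))⁺ ∈ ℕ∞`; this coincides with
`∞` when the reachable cycle is negative and with `max (0, -min_P w(P))`
(minimum over simple paths `P` from `s`) otherwise.
-/

open scoped BigOperators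

universe u

structure GameGraph (V : Type u) [Fintype V] [DecidableEq V] where
  E : Finset (V × V)
  VA : Finset V
  exists_succ : ∀ v : V, ∃ u : V, (v, u) ∈ E

namespace GameGraph

variable {V : Type u} [Fintype V] [DecidableEq V]

/-- Positional strategies of Alice: a choice of an out-edge at every node of Alice. -/
def AliceStrategy (G : GameGraph V) : Type u :=
  {σ : V → V // ∀ u ∈ G.VA, (u, σ u) ∈ G.E}

/-- Positional strategies of Bob: a choice of an out-edge at every node of Bob. -/
def BobStrategy (G : GameGraph V) : Type u :=
  {τ : V → V // ∀ u : V, u ∉ G.VA → (u, τ u) ∈ G.E}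

/-- The successor function of `G(σ,τ)`, the graph in which every node keeps only the
out-edge chosen by its owner's strategy. -/
def play (G : GameGraph V) (σ : G.AliceStrategy) (τ : G.BobStrategy) (v : V) : V :=
  if v ∈ G.VA then σ.1 v else τ.1 v

/-- Total weight of the length-`i` prefix of the unique path from `s` in the
functional graph with successor function `f`. -/
def prefixWeight (w : V → V → ℤ) (f : V → V) (s : V) (i : ℕ) : ℤ :=
  ∑ j ∈ Finset.range i, w (f^[j] s) (f^[j + 1] s)

/-- The minimal sufficient energy `e*_{G(σ,τ),w}(s)` at `s` for a fixed pair of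
strategies with induced successor function `f`:  the least initial energy
(in `ℕ∞ = ℤ≥0 ∪ {∞}`) keeping the running energy nonnegative forever.  It is `∞`
iff the unique cycle reachable from `s` is negative, and `max (0, -min_P w(P))`
(minimum over simple paths from `s`) otherwise. -/
noncomputable def stratEnergy (w : V → V → ℤ) (f : V → V) (s : V) : ℕ∞ :=
  ⨆ i : ℕ, ((-(prefixWeight w f s i)).toNat : ℕ∞)

/-- The minimal sufficient energy `e*_{G,w}(s) = min_σ max_τ e*_{G(σ,τ),w}(s)`. -/
noncomputable def minEnergy (G : GameGraph V) (w : V → V → ℤ) (s : V) : ℕ∞ :=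
  ⨅ σ : G.AliceStrategy, ⨆ τ : G.BobStrategy, stratEnergy w (G.play σ τ) s

/-- Alice wins at `s` iff the minimal sufficient energy at `s` is finite. -/
noncomputable def AliceWins (G : GameGraph V) (w : V → V → ℤ) (s : V) : Prop :=
  G.minEnergy w s ≠ ⊤

/-- The canonical embedding `ℕ∞ = ℤ≥0 ∪ {∞} → ℤ ∪ {∞}` (extended arithmetic:
`∞ + x = ∞`, `∞ ≥ x`). -/
def toZInf (x : ℕ∞) : WithTop ℤ :=
  if x = ⊤ then ⊤ else ((x.toNat : ℤ) : WithTop ℤ)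

/-- `max (x - z, 0)` for `x : ℕ∞` and `z : ℤ`, with `∞ - z = ∞`. -/
def esub (x : ℕ∞) (z : ℤ) : ℕ∞ :=
  if x = ⊤ then ⊤ else ((((x.toNat : ℤ) - z).toNat : ℕ) : ℕ∞)

/-- The successors of `u` in `G`. -/
def succs (G : GameGraph V) (u : V) : Finset V :=
  (G.E.filter (fun p => p.1 = u)).image Prod.snd

/-- The weight function with every weight rounded up to the nearest multiple of `B`:
`w_B(u,v) = ⌈w(u,v)/B⌉·B`. -/
def roundW (w : V → V → ℤ) (B : ℤ) : V → V → ℤ :=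
  fun u v => ⌈(w u v : ℚ) / (B : ℚ)⌉ * B

/-- `W = max_{(u,v) ∈ E} |w(u,v)|`. -/
def maxAbsW (G : GameGraph V) (w : V → V → ℤ) : ℕ :=
  G.E.sup (fun p => (w p.1 p.2).natAbs)

/-- A strategy `τ` of Bob is optimal if `e*_{G(σ,τ),w}(s) ≥ e*_{G,w}(s)` for every
node `s` and every strategy `σ` of Alice. -/
noncomputable def IsOptimalBob (G : GameGraph V) (w : V → V → ℤ) (τ : G.BobStrategy) : Prop :=
  ∀ (s : V) (σ : G.AliceStrategy), G.minEnergy w s ≤ stratEnergy w (G.play σ τ) s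

/-- Total weight of the cycle of length `L` through `x` in the functional graph `f`. -/
def cycleWeight (w : V → V → ℤ) (f : V → V) (x : V) (L : ℕ) : ℤ :=
  ∑ j ∈ Finset.range L, w (f^[j] x) (f^[j + 1] x)

/-- A node `s` has penalty at least `D ≥ 0` if there is an optimal strategy `τ*` of Bob
such that for every strategy `σ` of Alice the unique cycle `C` reachable from `s` in
`G(σ,τ*)` satisfies: if `w(C) < 0` then the average weight `w(C)/|C|` is at most `-D`.
(The cycle is described by any node `x` on it, reachable from `s`, together with its
minimal period `L`.) -/
noncomputable def HasPenaltyAtLeast (G : GameGraph V) (w : V → V → ℤ) (s : V) (D : ℝ) : Prop :=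
  ∃ τ : G.BobStrategy, G.IsOptimalBob w τ ∧
    ∀ σ : G.AliceStrategy, ∀ x : V, (∃ i : ℕ, (G.play σ τ)^[i] s = x) →
      ∀ L : ℕ, 0 < L → (G.play σ τ)^[L] x = x →
        (∀ k : ℕ, 0 < k → k < L → (G.play σ τ)^[k] x ≠ x) →
        cycleWeight w (G.play σ τ) x L < 0 →
        ((cycleWeight w (G.play σ τ) x L : ℝ) / (L : ℝ) ≤ -D)

end GameGraph

namespace GameGraph

variable {V : Type u} [Fintype V] [DecidableEq V]

/-- The complete bipartite game graph `G₂` obtained from a (bipartite) game graph `G`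
by adding all missing edges from Alice's nodes to Bob's nodes and from Bob's nodes
to Alice's nodes. -/
def completeBip (G : GameGraph V) : GameGraph V where
  E := G.E ∪ Finset.univ.filter (fun p : V × V =>
        (p.1 ∈ G.VA ∧ p.2 ∉ G.VA) ∨ (p.1 ∉ G.VA ∧ p.2 ∈ G.VA))
  VA := G.VA
  exists_succ := fun v => (G.exists_succ v).imp fun _ hu => Finset.mem_union_left _ hu

/-- The weights `w₂` of the completed game: original edges keep their weight; an added
edge gets weight `-nW` if it leaves a node of Alice and `n²W` if it leaves a node of
Bob, where `n = |V|` and `W = max_{(u,v) ∈ E} |w(u,v)|`. -/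
def completeBipW (G : GameGraph V) (w : V → V → ℤ) : V → V → ℤ := fun u v =>
  if (u, v) ∈ G.E then w u v
  else if u ∈ G.VA then -((Fintype.card V : ℤ) * (G.maxAbsW w : ℤ))
  else ((Fintype.card V : ℤ)) ^ 2 * (G.maxAbsW w : ℤ)

theorem prefixWeight_add {X : Type*} (w : X → X → ℤ) (f : X → X) (s : X) (i j : ℕ) :
    prefixWeight w f s (i + j) = prefixWeight w f s i + prefixWeight w f (f^[i] s) j := by
  simp only [prefixWeight, Finset.sum_range_add]
  congr 1
  refine Finset.sum_congr rfl fun k _ => ?_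
  rw [← Function.iterate_add_apply, ← Function.iterate_add_apply, add_comm i k,
    add_right_comm]

theorem prefixWeight_succ {X : Type*} (w : X → X → ℤ) (f : X → X) (s : X) (i : ℕ) :
    prefixWeight w f s (i + 1) = w s (f s) + prefixWeight w f (f s) i := by
  rw [add_comm, prefixWeight_add]
  simp [prefixWeight]

theorem prefixWeight_mul_of_periodic {X : Type*} (w : X → X → ℤ) {f : X → X} {s : X} {L : ℕ}
    (h : f^[L] s = s) (m : ℕ) :
    prefixWeight w f s (m * L) = m * prefixWeight w f s L := by
  induction m with
  | zero => simp [prefixWeight]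
  | succ m ih =>
    rw [Nat.succ_mul, add_comm, prefixWeight_add, h, ih]
    push_cast
    ring

theorem iterate_eq_of_agree {X : Type*} {f g : X → X} {s : X} {i : ℕ}
    (h : ∀ j < i, g (f^[j] s) = f (f^[j] s)) : ∀ j ≤ i, g^[j] s = f^[j] s := by
  intro j
  induction j with
  | zero => simp
  | succ j ih =>
    intro hj
    rw [Function.iterate_succ_apply', Function.iterate_succ_apply', ih (by omega), h j (by omega)]

theorem prefixWeight_eq_of_agree {X : Type*} (w : X → X → ℤ) {f g : X → X} {s : X} {i : ℕ}
    (h : ∀ j < i, g (f^[j] s) = f (f^[j] s)) :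
    prefixWeight w g s i = prefixWeight w f s i := by
  refine Finset.sum_congr rfl fun j hj => ?_
  rw [Finset.mem_range] at hj
  rw [iterate_eq_of_agree h j hj.le, iterate_eq_of_agree h (j + 1) hj]

/-- A potential that grows along `f` by at most the edge weights bounds the energy. -/
theorem neg_prefixWeight_le_of_potential {X : Type*} {w : X → X → ℤ} {f : X → X}
    {T : Set X} {p : X → ℕ}
    (h : ∀ y ∈ T, f y ∈ T ∧ (p (f y) : ℤ) ≤ p y + w y (f y)) (i : ℕ) :
    ∀ y ∈ T, -prefixWeight w f y i ≤ p y := by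
  induction i with
  | zero => intro y _; simp [prefixWeight]
  | succ i ih =>
    intro y hy
    have h₁ := ih _ (h y hy).1
    have h₂ := (h y hy).2
    rw [prefixWeight_succ]
    linarith

/-- Initial energy `N` at `v` suffices for the strategy `σ` of Alice. -/
def EnergyBound (G : GameGraph V) (w : V → V → ℤ) (σ : G.AliceStrategy) (v : V) (N : ℕ) : Prop :=
  ∀ (τ : G.BobStrategy) (i : ℕ), -prefixWeight w (G.play σ τ) v i ≤ N

theorem aliceWins_iff (G : GameGraph V) (w : V → V → ℤ) (v : V) :
    G.AliceWins w v ↔ ∃ σ N, G.EnergyBound w σ v N := by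
  have key : ∀ σ N, G.EnergyBound w σ v N ↔
      (⨆ τ : G.BobStrategy, stratEnergy w (G.play σ τ) v) ≤ (N : ℕ∞) := by
    intro σ N
    simp only [EnergyBound, stratEnergy, iSup_le_iff, Nat.cast_le, Int.toNat_le]
  unfold AliceWins minEnergy
  rw [Ne, iInf_eq_top, not_forall]
  refine exists_congr fun σ => ⟨fun h => ?_, ?_⟩
  · obtain ⟨N, hN⟩ := ENat.ne_top_iff_exists.1 h
    exact ⟨N, (key σ N).2 hN.ge⟩
  · rintro ⟨N, hN⟩
    exact ne_top_of_le_ne_top (ENat.natCast_ne_top N) ((key σ N).1 hN)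

theorem play_mem_E (G : GameGraph V) (σ : G.AliceStrategy) (τ : G.BobStrategy) (v : V) :
    (v, G.play σ τ v) ∈ G.E := by
  unfold play
  split_ifs with h
  · exact σ.2 v h
  · exact τ.2 v h

theorem play_eq_of_mem (G : GameGraph V) (σ : G.AliceStrategy) (τ : G.BobStrategy) {v : V}
    (h : v ∈ G.VA) : G.play σ τ v = σ.1 v := if_pos h

/-- Bob may switch to any edge consistent with `σ`. -/
theorem exists_play_eq_update (G : GameGraph V) (σ : G.AliceStrategy) (τ : G.BobStrategy) {v u : V}
    (huv : (v, u) ∈ G.E) (hσ : v ∈ G.VA → u = σ.1 v) :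
    ∃ τ' : G.BobStrategy, G.play σ τ' = Function.update (G.play σ τ) v u := by
  refine ⟨⟨Function.update τ.1 v u, fun y hy => ?_⟩, ?_⟩
  · rcases eq_or_ne y v with rfl | hne
    · simpa using huv
    · simpa [hne] using τ.2 y hy
  · funext y
    rcases eq_or_ne y v with rfl | hne
    · by_cases hy : y ∈ G.VA
      · simp [play, hy, hσ hy]
      · simp [play, hy]
    · simp [play, hne]

/-- Sufficient energies propagate along every edge consistent with `σ`. -/
theorem EnergyBound.step {G : GameGraph V} {w : V → V → ℤ} {σ : G.AliceStrategy} {v u : V} {N : ℕ}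
    (h : G.EnergyBound w σ v N) (huv : (v, u) ∈ G.E) (hσ : v ∈ G.VA → u = σ.1 v) :
    ∃ M : ℕ, (M : ℤ) = N + w v u ∧ G.EnergyBound w σ u M := by
  have main : ∀ (τ : G.BobStrategy) (i : ℕ),
      -prefixWeight w (G.play σ τ) u i ≤ N + w v u := by
    intro τ i
    obtain ⟨τ', hτ'⟩ := G.exists_play_eq_update σ τ huv hσ
    have hv : G.play σ τ' v = u := by simp [hτ']
    by_cases hit : ∃ j, j < i ∧ (G.play σ τ)^[j] u = v
    · classical
      obtain ⟨hji, hj⟩ := Nat.find_spec hit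
      have hmin : ∀ k < Nat.find hit, (G.play σ τ)^[k] u ≠ v := fun k hk hkv =>
        Nat.find_min hit hk ⟨hk.trans hji, hkv⟩
      generalize Nat.find hit = j at hji hj hmin
      have hag : ∀ k < j, G.play σ τ' ((G.play σ τ)^[k] u) =
          G.play σ τ ((G.play σ τ)^[k] u) := fun k hk => by
        rw [hτ', Function.update_of_ne (hmin k hk)]
      have hper : (G.play σ τ')^[j + 1] v = v := by
        rw [Function.iterate_succ_apply, hv, iterate_eq_of_agree hag j le_rfl, hj]
      have hcyc : 0 ≤ prefixWeight w (G.play σ τ') v (j + 1) := by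
        by_contra! hneg
        have h₁ := h τ' ((N + 1) * (j + 1))
        rw [prefixWeight_mul_of_periodic w hper] at h₁
        push_cast at h₁
        nlinarith
      rw [prefixWeight_succ, hv, prefixWeight_eq_of_agree w hag] at hcyc
      obtain ⟨k, rfl⟩ := Nat.exists_eq_add_of_lt hji
      have h₂ := h τ (k + 1)
      rw [add_assoc, prefixWeight_add, hj]
      linarith
    · push Not at hit
      have hag : ∀ k < i, G.play σ τ' ((G.play σ τ)^[k] u) =
          G.play σ τ ((G.play σ τ)^[k] u) := fun k hk => by
        rw [hτ', Function.update_of_ne (hit k hk)]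
      have h₁ := h τ' (i + 1)
      rw [prefixWeight_succ, hv, prefixWeight_eq_of_agree w hag] at h₁
      linarith
  choose g hg using G.exists_succ
  have h₀ := main ⟨g, fun y _ => hg y⟩ 0
  simp only [prefixWeight, Finset.range_zero, Finset.sum_empty, neg_zero] at h₀
  refine ⟨(N + w v u).toNat, Int.toNat_of_nonneg h₀, fun τ i => ?_⟩
  rw [Int.toNat_of_nonneg h₀]
  exact main τ i

theorem abs_le_maxAbsW (G : GameGraph V) (w : V → V → ℤ) {u v : V} (h : (u, v) ∈ G.E) :
    |w u v| ≤ G.maxAbsW w := by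
  have := Finset.le_sup (f := fun p : V × V => (w p.1 p.2).natAbs) h
  rw [Int.abs_eq_natAbs]
  exact_mod_cast this

/-- `p` grows by at most the edge weight along every edge consistent with `σ`. -/
def IsPotential (G : GameGraph V) (w : V → V → ℤ) (σ : G.AliceStrategy) (p : V → ℕ) : Prop :=
  ∀ v u, (v, u) ∈ G.E → (v ∈ G.VA → u = σ.1 v) → (p u : ℤ) ≤ p v + w v u

theorem exists_isPotential (G : GameGraph V) (w : V → V → ℤ) (h : ∀ v, G.AliceWins w v) :
    ∃ σ p, G.IsPotential w σ p := by
  have hne : ∀ v, {N | ∃ σ, G.EnergyBound w σ v N}.Nonempty := fun v => by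
    obtain ⟨σ, N, hN⟩ := (G.aliceWins_iff w v).1 (h v)
    exact ⟨N, σ, hN⟩
  choose S hS using fun v => Nat.sInf_mem (hne v)
  refine ⟨⟨fun v => (S v).1 v, fun v hv => (S v).2 v hv⟩,
    fun v => sInf {N | ∃ σ, G.EnergyBound w σ v N}, fun v u huv hσ => ?_⟩
  obtain ⟨M, hM, hb⟩ := (hS v).step huv hσ
  rw [← hM]
  exact_mod_cast Nat.sInf_le (s := {N | ∃ σ, G.EnergyBound w σ u N}) ⟨S v, hb⟩

theorem exists_le_card_notMem_range {X : Type*} [Fintype X] (g : X → ℕ) :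
    ∃ k ≤ Fintype.card X, ∀ v, g v ≠ k := by
  by_contra! h
  have hsub : Finset.range (Fintype.card X + 1) ⊆ Finset.univ.image g := fun k hk => by
    obtain ⟨v, hv⟩ := h k (by simpa [Nat.lt_succ_iff] using hk)
    exact Finset.mem_image.2 ⟨v, Finset.mem_univ v, hv⟩
  have := (Finset.card_le_card hsub).trans Finset.card_image_le
  simp at this

/-- Lowering the part of a potential above a gap of length `W` keeps it a potential. -/
theorem IsPotential.lower {G : GameGraph V} {w : V → V → ℤ} {σ : G.AliceStrategy} {p : V → ℕ}
    (hp : G.IsPotential w σ p) {t : ℕ} (ht : 0 < t + G.maxAbsW w)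
    (hgap : ∀ v, p v < t ∨ t + G.maxAbsW w ≤ p v) :
    G.IsPotential w σ fun v => if p v < t then p v else p v - 1 := by
  intro v u huv hσ
  have h₁ := hp v u huv hσ
  have h₂ := abs_le.1 (G.abs_le_maxAbsW w huv)
  have h₃ := hgap v
  have h₄ := hgap u
  dsimp only
  split_ifs <;> omega

theorem exists_isPotential_le (G : GameGraph V) (w : V → V → ℤ) {σ : G.AliceStrategy}
    (h : ∃ p, G.IsPotential w σ p) :
    ∃ p, G.IsPotential w σ p ∧ ∀ v, p v ≤ Fintype.card V * G.maxAbsW w := by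
  obtain ⟨p, hp, hmin⟩ :=
    (measure fun p : V → ℕ => ∑ v, p v).wf.has_min {p | G.IsPotential w σ p} h
  refine ⟨p, hp, fun x => ?_⟩
  by_contra! hx
  obtain ⟨t, ht, hgap, htx⟩ : ∃ t, 0 < t + G.maxAbsW w ∧
      (∀ v, p v < t ∨ t + G.maxAbsW w ≤ p v) ∧ t ≤ p x := by
    rcases Nat.eq_zero_or_pos (G.maxAbsW w) with hW | hW
    · exact ⟨p x, by omega, fun v => by omega, le_rfl⟩
    · obtain ⟨k, hk, hkr⟩ := exists_le_card_notMem_range fun v => p v / G.maxAbsW w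
      refine ⟨k * G.maxAbsW w, by omega, fun v => ?_, (Nat.mul_le_mul_right _ hk).trans hx.le⟩
      rcases lt_or_gt_of_ne (hkr v) with hlt | hgt
      · exact Or.inl ((Nat.div_lt_iff_lt_mul hW).1 hlt)
      · right
        rw [← Nat.succ_mul]
        exact (Nat.le_div_iff_mul_le hW).1 hgt
  refine hmin _ (IsPotential.lower hp ht hgap) ?_
  change ∑ v, (if p v < t then p v else p v - 1) < ∑ v, p v
  refine Finset.sum_lt_sum (fun v _ => ?_) ⟨x, Finset.mem_univ x, ?_⟩
  · split_ifs <;> omega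
  · rw [if_neg (by omega)]
    omega

theorem completeBip_aliceWins (G : GameGraph V) (w : V → V → ℤ) (h : ∀ v, G.AliceWins w v)
    (v : V) : (completeBip G).AliceWins (completeBipW G w) v := by
  obtain ⟨σ, hσ⟩ := G.exists_isPotential w h
  obtain ⟨p, hp, hle⟩ := G.exists_isPotential_le w hσ
  let σ₂ : (completeBip G).AliceStrategy :=
    ⟨σ.1, fun u hu => Finset.mem_union_left _ (σ.2 u hu)⟩
  refine (aliceWins_iff _ _ _).2 ⟨σ₂, p v, fun τ i =>
    neg_prefixWeight_le_of_potential (T := Set.univ) (fun y _ => ⟨trivial, ?_⟩) i v trivial⟩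
  by_cases hy : y ∈ G.VA
  · have hplay : (completeBip G).play σ₂ τ y = σ.1 y := play_eq_of_mem _ σ₂ τ hy
    rw [hplay, completeBipW, if_pos (σ.2 y hy)]
    exact hp y _ (σ.2 y hy) fun _ => rfl
  · generalize (completeBip G).play σ₂ τ y = u
    unfold completeBipW
    split_ifs with hE
    · exact hp y u hE fun hy' => absurd hy' hy
    · have hn : 1 ≤ Fintype.card V := Fintype.card_pos_iff.2 ⟨v⟩
      have h₁ : p u ≤ Fintype.card V ^ 2 * G.maxAbsW w :=
        (hle u).trans (Nat.mul_le_mul_right _ (by nlinarith))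
      have h₂ : (p u : ℤ) ≤ (Fintype.card V : ℤ) ^ 2 * G.maxAbsW w := by exact_mod_cast h₁
      linarith [Int.natCast_nonneg (p y)]

/-- If Alice wins from every node of a set closed under the given strategy and under
Bob's edges, witnessed by a potential, then she wins from each node of that set. -/
theorem aliceWins_of_potential_on (G : GameGraph V) (w : V → V → ℤ) (f : V → V) (T : Set V)
    (p : V → ℕ) (hA : ∀ y ∈ T, y ∈ G.VA → (y, f y) ∈ G.E)
    (h : ∀ y ∈ T, ∀ u, (y, u) ∈ G.E → (y ∈ G.VA → u = f y) →
      u ∈ T ∧ (p u : ℤ) ≤ p y + w y u) {y : V} (hy : y ∈ T) : G.AliceWins w y := by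
  classical
  choose g hg using G.exists_succ
  let σ : G.AliceStrategy := ⟨fun y => if y ∈ T then f y else g y, fun u hu => by
    dsimp only
    split_ifs with hT
    · exact hA u hT hu
    · exact hg u⟩
  refine (aliceWins_iff _ _ _).2 ⟨σ, p y, fun τ i =>
    neg_prefixWeight_le_of_potential (fun z hz => ?_) i y hy⟩
  refine h z hz _ (G.play_mem_E σ τ z) fun hzA => ?_
  rw [G.play_eq_of_mem σ τ hzA]
  exact if_pos hz

theorem exists_aliceWins_of_completeBip (G : GameGraph V) (w : V → V → ℤ) {v : V}
    (h : (completeBip G).AliceWins (completeBipW G w) v) : ∃ y, G.AliceWins w y := by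
  classical
  rcases Nat.eq_zero_or_pos (G.maxAbsW w) with hW | hW
  · choose g hg using G.exists_succ
    refine ⟨v, G.aliceWins_of_potential_on w g Set.univ (fun _ => 0) (fun y _ _ => hg y)
      (fun y _ u hu _ => ⟨trivial, ?_⟩) trivial⟩
    have := abs_le.1 (G.abs_le_maxAbsW w hu)
    rw [hW] at this
    simpa using this.1
  obtain ⟨σ, hσ⟩ := (aliceWins_iff _ _ _).1 h
  let B : V → Set ℕ := fun y => {N | (completeBip G).EnergyBound (completeBipW G w) σ y N}
  let p : V → ℕ := fun y => sInf (B y)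
  have hstep : ∀ y u, (B y).Nonempty → (y, u) ∈ (completeBip G).E → (y ∈ G.VA → u = σ.1 y) →
      (B u).Nonempty ∧ (p u : ℤ) ≤ p y + completeBipW G w y u := by
    intro y u hy hyu hA
    obtain ⟨M, hM, hb⟩ := EnergyBound.step (Nat.sInf_mem hy) hyu hA
    refine ⟨⟨M, hb⟩, ?_⟩
    change (p u : ℤ) ≤ (sInf (B y) : ℕ) + _
    erw [← hM]
    exact_mod_cast Nat.sInf_le hb
  obtain ⟨x, hx, hxmin⟩ : ∃ x, (B x).Nonempty ∧ ∀ y, (B y).Nonempty → p x ≤ p y := by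
    obtain ⟨x, hx, hm⟩ := (measure p).wf.has_min {y | (B y).Nonempty} ⟨v, hσ⟩
    exact ⟨x, hx, fun y hy => not_lt.1 (hm y hy)⟩
  obtain ⟨k, hk, hkr⟩ := exists_le_card_notMem_range fun y => (p y - p x) / G.maxAbsW w
  have hkW := Nat.mul_le_mul_right (G.maxAbsW w) hk
  have hgap : ∀ y, p y - p x < k * G.maxAbsW w + G.maxAbsW w → p y - p x < k * G.maxAbsW w := by
    intro y hy
    rw [← Nat.succ_mul, ← Nat.div_lt_iff_lt_mul hW] at hy
    exact (Nat.div_lt_iff_lt_mul hW).1 (lt_of_le_of_ne (Nat.lt_succ_iff.1 hy) (hkr y))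
  have hmemE : ∀ y u, (y, u) ∈ G.E → (y, u) ∈ (completeBip G).E :=
    fun _ _ hE => Finset.mem_union_left _ hE
  refine ⟨x, G.aliceWins_of_potential_on w σ.1
    {y | (B y).Nonempty ∧ p y - p x < k * G.maxAbsW w} p ?_ ?_
    ⟨hx, hgap x (by omega)⟩⟩
  · rintro y ⟨hy, hyk⟩ hyA
    by_contra hE
    obtain ⟨hu, hpu⟩ := hstep y (σ.1 y) hy (σ.2 y hyA) fun _ => rfl
    rw [completeBipW, if_neg hE, if_pos hyA] at hpu
    have h₁ := hxmin _ hu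
    have h₂ := hxmin y hy
    zify at hkW h₁
    have h₃ : (p y : ℤ) - p x < k * G.maxAbsW w := by
      zify [h₂] at hyk
      exact hyk
    linarith
  · rintro y ⟨hy, hyk⟩ u hE hA
    obtain ⟨hu, hpu⟩ := hstep y u hy (hmemE y u hE) hA
    rw [completeBipW, if_pos hE] at hpu
    have h₁ := hxmin y hy
    have h₂ := (abs_le.1 (G.abs_le_maxAbsW w hE)).2
    exact ⟨⟨hu, hgap u (by omega)⟩, hpu⟩

/-- Let `(G,w)` be a bipartite energy game in which one player wins at every node, and
let `(G₂,w₂)` be the completed game.  Then the same player wins at every node of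
`(G₂,w₂)`: if Alice wins everywhere in `(G,w)` then she wins everywhere in `(G₂,w₂)`,
and if Bob wins everywhere in `(G,w)` then he wins everywhere in `(G₂,w₂)`. -/
theorem completeBip_same_winner (G : GameGraph V) (w : V → V → ℤ)
    (hbip : ∀ p ∈ G.E, (p.1 ∈ G.VA ↔ p.2 ∉ G.VA))
    (hone : (∀ v : V, G.AliceWins w v) ∨ (∀ v : V, ¬ G.AliceWins w v)) :
    ((∀ v : V, G.AliceWins w v) →
      ∀ v : V, (completeBip G).AliceWins (completeBipW G w) v) ∧
    ((∀ v : V, ¬ G.AliceWins w v) →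
      ∀ v : V, ¬ (completeBip G).AliceWins (completeBipW G w) v) := by
  refine ⟨G.completeBip_aliceWins w, fun h v hv => ?_⟩
  obtain ⟨y, hy⟩ := G.exists_aliceWins_of_completeBip w hv
  exact h y hy

end GameGraph
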